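/- (Beliakova–Blanchet recursion and product formula, affine case.) For each 0 ≤ m ≤ k−2 suppose Z_m^{(ℓ)} (ℓ ∈ ℤ) are elements of the subalgebra of W_k generated by T_1,…,T_{m−1}, E_1,…,E_{m−1}, Y_1^{±1},…,Y_m^{±1} satisfying E_{m+1} Y_{m+1}^ℓ E_{m+1} = Z_m^{(ℓ)} E_{m+1}, and set Z_m⁺ = Σ_{ℓ≥0} Z_m^{(ℓ)} u^{−ℓ}. Then in the ring of formal Laurent series in u⁻¹ over W_k: (i) for 1 ≤ i ≤ k−2, ( Z_i⁺ + z⁻¹/(q−q⁻¹) − u²/(u²−1) ) E_{i+1} = ( Z_{i−1}⁺ + z⁻¹/(q−q⁻¹) − u²/(u²−1) ) · (u−Y_i)²(u−q⁻²Y_i⁻¹)(u−q²Y_i⁻¹) / ( (u−Y_i⁻¹)²(u−q²Y_i)(u−q⁻²Y_i) ) · E_{i+1}; and (ii) consequently, for 1 ≤ m ≤ k−2, ( Z_m⁺ + z⁻¹/(q−q⁻¹) − u²/(u²−1) ) E_{m+1} = ( Z_0⁺ + z⁻¹/(q−q⁻¹) − u²/(u²−1) ) ∏_{i=1}^{m}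 (u−Y_i)²(u−q⁻²Y_i⁻¹)(u−q²Y_i⁻¹) / ( (u−Y_i⁻¹)²(u−q²Y_i)(u−q⁻²Y_i) ) · E_{m+1}, where Z_0⁺ = Σ_{ℓ≥0} Z_0^{(ℓ)} u^{−ℓ}. -/

import Mathlib

/-- A `C`-algebra `A` together with elements satisfying the defining relations of the
affine BMW algebra `W_k` with parameters `q, z ∈ Cˣ` and `Z₀⁽ℓ⁾ ∈ C` (`ℓ ∈ ℤ`).
Indexing is 0-based: the paper's `T_i, E_i` (for `1 ≤ i ≤ k-1`) are `T (i-1) _, E (i-1) _`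
here, and the paper's `Y_i` (for `1 ≤ i ≤ k`) is `Y (i-1)`.  The fields `Y_zero`, `Y_succ`
say `Y₁ = z X^{ε₁}`, `Y_{i+1} = T_i Y_i T_i`, and `E_def` is the equation
`T_i Y_i = Y_{i+1} T_i - (q - q⁻¹) Y_{i+1} (1 - E_i)` defining `E_i`. -/
structure AffBMW (C : Type*) [CommRing C] (k : ℕ) (q z : Cˣ) (Z₀ : ℤ → C)
    (A : Type*) [Ring A] [Algebra C A] where
  T : ∀ i : ℕ, i + 1 < k → A
  Tinv : ∀ i : ℕ, i + 1 < k → A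
  X : A
  E : ∀ i : ℕ, i + 1 < k → A
  Y : ℕ → A
  Yinv : ℕ → A
  T_Tinv : ∀ i (h : i + 1 < k), T i h * Tinv i h = 1
  Tinv_T : ∀ i (h : i + 1 < k), Tinv i h * T i h = 1
  braid_far : ∀ i j (hi : i + 1 < k) (hj : j + 1 < k), i + 2 ≤ j →
      T i hi * T j hj = T j hj * T i hi
  braid : ∀ i (h : i + 2 < k),
      T i (by omega) * T (i + 1) h * T i (by omega) =
        T (i + 1) h * T i (by omega) * T (i + 1) h
  XTXT : ∀ h : 1 < k, X * T 0 h * X * T 0 h = T 0 h * X * T 0 h * X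
  X_T : ∀ i (h : i + 1 < k), 1 ≤ i → X * T i h = T i h * X
  Y_zero : Y 0 = (z : C) • X
  Y_succ : ∀ i (h : i + 1 < k), Y (i + 1) = T i h * Y i * T i h
  Y_Yinv : ∀ i, i < k → Y i * Yinv i = 1
  Yinv_Y : ∀ i, i < k → Yinv i * Y i = 1
  E_def : ∀ i (h : i + 1 < k),
      T i h * Y i =
        Y (i + 1) * T i h -
          ((q : C) - ((q⁻¹ : Cˣ) : C)) • (Y (i + 1) * (1 - E i h))
  E_T : ∀ i (h : i + 1 < k), E i h * T i h = ((z⁻¹ : Cˣ) : C) • E i h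
  T_E : ∀ i (h : i + 1 < k), T i h * E i h = ((z⁻¹ : Cˣ) : C) • E i h
  E_Tinv : ∀ i (h : i + 1 < k), E i h * Tinv i h = (z : C) • E i h
  Tinv_E : ∀ i (h : i + 1 < k), Tinv i h * E i h = (z : C) • E i h
  ETE_up : ∀ i (h : i + 1 < k) (h' : i + 2 < k),
      E i h * T (i + 1) h' * E i h = (z : C) • E i h
  ETinvE_up : ∀ i (h : i + 1 < k) (h' : i + 2 < k),
      E i h * Tinv (i + 1) h' * E i h = ((z⁻¹ : Cˣ) : C) • E i h
  ETE_down : ∀ i (h : i + 1 < k) (h' : i - 1 + 1 < k), 1 ≤ i →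
      E i h * T (i - 1) h' * E i h = (z : C) • E i h
  ETinvE_down : ∀ i (h : i + 1 < k) (h' : i - 1 + 1 < k), 1 ≤ i →
      E i h * Tinv (i - 1) h' * E i h = ((z⁻¹ : Cˣ) : C) • E i h
  EYE : ∀ (h : 1 < k) (ℓ : ℤ),
      E 0 h * (if 0 ≤ ℓ then Y 0 ^ ℓ.toNat else Yinv 0 ^ (-ℓ).toNat) * E 0 h =
        Z₀ ℓ • E 0 h
  E_YY : ∀ i (h : i + 1 < k), E i h * (Y i * Y (i + 1)) = E i h
  YY_E : ∀ i (h : i + 1 < k), (Y i * Y (i + 1)) * E i h = E i h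

noncomputable section

/-- `a/(u - a) := Σ_{ℓ≥1} a^ℓ u^{-ℓ}`, a formal Laurent series in `u⁻¹`
(an element of `LaurentSeries A = HahnSeries ℤ A` whose variable is `u⁻¹`). -/
def geomU {A : Type*} [Ring A] (a : A) : LaurentSeries A :=
  HahnSeries.ofPowerSeries ℤ A (PowerSeries.mk fun n => if n = 0 then 0 else a ^ n)

/-- `1/(u - a) := Σ_{ℓ≥1} a^{ℓ-1} u^{-ℓ}`. -/
def invU {A : Type*} [Ring A] (a : A) : LaurentSeries A :=
  HahnSeries.ofPowerSeries ℤ A (PowerSeries.mk fun n => if n = 0 then 0 else a ^ (n - 1))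

/-- `a/(u² - a) := Σ_{ℓ≥1} a^ℓ u^{-2ℓ}`. -/
def geomU2 {A : Type*} [Ring A] (a : A) : LaurentSeries A :=
  HahnSeries.ofPowerSeries ℤ A
    (PowerSeries.mk fun n => if n = 0 then 0 else if n % 2 = 0 then a ^ (n / 2) else 0)

/-- `1/(u² - a) := Σ_{ℓ≥1} a^{ℓ-1} u^{-2ℓ}`. -/
def invU2 {A : Type*} [Ring A] (a : A) : LaurentSeries A :=
  HahnSeries.ofPowerSeries ℤ A
    (PowerSeries.mk fun n => if n = 0 then 0 else if n % 2 = 0 then a ^ (n / 2 - 1) else 0)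

/-- `u²/(u² - 1) := Σ_{m≥0} u^{-2m}`. -/
def selfU2 (A : Type*) [Ring A] : LaurentSeries A :=
  HahnSeries.ofPowerSeries ℤ A (PowerSeries.mk fun n => if n % 2 = 0 then 1 else 0)

/-- `1/(u² - 1) := Σ_{m≥1} u^{-2m}`. -/
def invU2one (A : Type*) [Ring A] : LaurentSeries A :=
  HahnSeries.ofPowerSeries ℤ A
    (PowerSeries.mk fun n => if n = 0 then 0 else if n % 2 = 0 then 1 else 0)

/-- The variable `u` itself (the inverse of the Laurent series variable `u⁻¹`). -/
def Uvar (A : Type*) [Ring A] : LaurentSeries A := HahnSeries.single (-1 : ℤ) 1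

/-- A constant Laurent series. -/
def cst {A : Type*} [Ring A] (a : A) : LaurentSeries A := HahnSeries.C a

end

noncomputable section

/-- The rational factor
`(u-Y)²(u-q⁻²Y⁻¹)(u-q²Y⁻¹) / ((u-Y⁻¹)²(u-q²Y)(u-q⁻²Y))`
as a formal Laurent series in `u⁻¹`, where `1/(u-a) := Σ_{ℓ≥1} a^{ℓ-1} u^{-ℓ}`.
Here `Yi` stands for `Y_i` and `Yiinv` for `Y_i⁻¹`. -/
def bbFactor {C : Type*} [CommRing C] (q : Cˣ) {A : Type*} [Ring A] [Algebra C A]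
    (Yi Yiinv : A) : LaurentSeries A :=
  (Uvar A - cst Yi) ^ 2 *
    (Uvar A - cst (((q⁻¹ : Cˣ) : C) ^ 2 • Yiinv)) *
    (Uvar A - cst ((q : C) ^ 2 • Yiinv)) *
    (invU Yiinv * invU Yiinv) *
    (invU ((q : C) ^ 2 • Yi) * invU (((q⁻¹ : Cˣ) : C) ^ 2 • Yi))

end

/-- If `β T = T α - P` then `β⁻¹ T = T α⁻¹ + β⁻¹ P α⁻¹`. -/
theorem resolvent_intertwine {L : Type*} [Ring L] {α α' β β' T P : L}
    (hβ : β' * β = 1) (hα : α * α' = 1) (h : β * T = T * α - P) :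
    β' * T = T * α' + β' * P * α' := by
  have h1 : β' * (β * T) * α' = β' * (T * α - P) * α' := by rw [h]
  rw [← mul_assoc, hβ, one_mul, mul_sub, sub_mul, mul_assoc β', mul_assoc T, hα, mul_one] at h1
  rw [h1]; abel

/-- Moving the resolvent `Rb = (u - b)⁻¹` past `T` in `E' Rb E'`, with `b = T a T`, expresses
`w` (where `E' Rb E' = u⁻¹ w`) through the resolvents `Ra`, `Ri` of `a`, `a⁻¹` and `ζ`
(where `E Ra E = u⁻¹ ζ E`). -/
theorem resolvent_bmw_relation {K L : Type*} [CommRing K] [Ring L] [Algebra K L]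
    (u v κ z zi x : K) (a ai b T Ti E T' Ti' E' Ra Rb Ri ζ w : L)
    (huv : u * v = 1)
    (hT : T * Ti = 1) (hTi : Ti = T - κ • (1 - E))
    (hbTi : b * Ti = T * a) (hTib : Ti * b = a * T)
    (hRa : (u • 1 - a) * Ra = 1) (hRa' : Ra * (u • 1 - a) = 1)
    (hRb : (u • 1 - b) * Rb = 1) (hRb' : Rb * (u • 1 - b) = 1)
    (hRi : (u • 1 - ai) * Ri = 1) (hRi' : Ri * (u • 1 - ai) = 1)
    (hbE : b * E = ai * E) (hEb : E * b = E * ai)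
    (hET : E * T = zi • E)
    (hmulT : E' * T = E' * E * Ti') (hTimul : Ti * E' = T' * E * E')
    (hsandT : E' * T * E' = z • E') (hsandTi : E' * Ti * E' = zi • E')
    (hsandE : E' * E * E' = E') (hEsq : E' * E' = x • E')
    (hTT' : Ti' * T' = 1)
    (cRaT' : Commute Ra T') (cRaE' : Commute Ra E') (cRab : Commute Ra b)
    (cRib : Commute Ri b) (cRiE' : Commute Ri E')
    (caiE' : Commute ai E')
    (cζE' : Commute ζ E')
    (hζ : E * Ra * E = v • (ζ * E)) (hw : E' * Rb * E' = v • w) :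
    w = ζ * E' + (κ * u) • (Ra * (u • (z • (Ra * E') + κ • (Ra * (w - x • E'))
          - κ • (ai * Ri * Ra * E') - (κ * v) • w + κ • (Ri * E')) - zi • E'))
        - (κ * u) • (ai * Ri * (zi • (Ri * E') - (κ * u) • (Ri * Ra * E') + κ • (ζ * Ri * E'))) := by
  have bRb : b * Rb = u • Rb - 1 := by
    rw [← hRb, sub_mul, smul_mul_assoc, one_mul]; abel
  have Rbb : Rb * b = u • Rb - 1 := by
    rw [← hRb', mul_sub, mul_smul_comm, mul_one]; abel
  have RbE : Rb * E = Ri * E := by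
    have h : (u • 1 - b) * (Ri * E) = E := by
      calc (u • 1 - b) * (Ri * E) = Ri * (u • E - b * E) := by
            simp only [sub_mul, mul_sub, smul_mul_assoc, mul_smul_comm, one_mul, ← mul_assoc,
              cRib.eq]
        _ = (Ri * (u • 1 - ai)) * E := by
            rw [hbE]
            simp only [sub_mul, mul_sub, smul_mul_assoc, mul_smul_comm, mul_one, ← mul_assoc]
        _ = E := by rw [hRi', one_mul]
    calc Rb * E = Rb * ((u • 1 - b) * (Ri * E)) := by rw [h]
      _ = Ri * E := by rw [← mul_assoc, hRb', one_mul]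
  have ERb : E * Rb = E * Ri := by
    have h : (E * Ri) * (u • 1 - b) = E := by
      calc (E * Ri) * (u • 1 - b) = (u • E - E * b) * Ri := by
            simp only [sub_mul, mul_sub, smul_mul_assoc, mul_smul_comm, mul_one, mul_assoc,
              cRib.eq]
        _ = E * ((u • 1 - ai) * Ri) := by
            rw [hEb]
            simp only [sub_mul, mul_sub, smul_mul_assoc, mul_smul_comm, one_mul, mul_assoc]
        _ = E := by rw [hRi, mul_one]
    calc E * Rb = ((E * Ri) * (u • 1 - b)) * Rb := by rw [h]
      _ = E * Ri := by rw [mul_assoc, hRb, mul_one]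
  have bT : T * a = b * T - κ • (b * (1 - E)) := by
    rw [← hbTi, hTi, mul_sub, mul_smul_comm]
  have aT : a * T = T * b - κ • ((1 - E) * b) := by
    rw [← hTib, hTi, sub_mul, smul_mul_assoc]
  have cRaRb : Commute Ra Rb := by
    have h : Commute Ra (u • 1 - b) := ((Commute.one_right Ra).smul_right u).sub_right cRab
    calc Ra * Rb = Rb * (u • 1 - b) * Ra * Rb := by rw [hRb', one_mul]
      _ = Rb * Ra := by rw [mul_assoc Rb, ← h.eq, mul_assoc, mul_assoc Ra, hRb, mul_one]
  have cRabRb : Commute Ra (b * Rb) := by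
    rw [bRb]
    exact (cRaRb.smul_right u).sub_right (Commute.one_right Ra)
  have bRiE : b * Ri * E = ai * Ri * E := by
    have h1 : ai * Ri = Ri * ai := by
      have := hRi.trans hRi'.symm
      rw [sub_mul, mul_sub, smul_mul_assoc, mul_smul_comm, one_mul, mul_one] at this
      exact sub_right_injective this
    rw [← cRib.eq, mul_assoc, hbE, h1, mul_assoc]
  have caiRiE' : Commute (ai * Ri) E' := caiE'.mul_left cRiE'
  have RbT : Rb * T = T * Ra + κ • (b * Rb * (1 - E) * Ra) := by
    rw [resolvent_intertwine hRb' hRa (P := κ • (b * (1 - E))), bRb, ← Rbb]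
    · simp only [mul_smul_comm, smul_mul_assoc, mul_assoc]
    · rw [mul_sub T, mul_smul_comm, mul_one, bT, sub_mul, smul_mul_assoc, one_mul]
      abel
  have RaT : Ra * T = T * Rb - κ • (Ra * (1 - E) * (b * Rb)) := by
    rw [resolvent_intertwine hRa' hRb (P := -(κ • ((1 - E) * b)))]
    · simp only [mul_smul_comm, smul_mul_assoc, mul_assoc, mul_neg, neg_mul]
      abel
    · rw [mul_sub T, mul_smul_comm, mul_one, sub_mul, smul_mul_assoc, one_mul, aT]
      abel
  have RbExp : Rb = T * Ra * Ti + κ • (b * Rb * (1 - E) * Ra * Ti) := by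
    calc Rb = Rb * T * Ti := by rw [mul_assoc, hT, mul_one]
      _ = _ := by rw [RbT, add_mul, smul_mul_assoc]
  have s1 : E' * (T * Ra * Ti) * E' = v • (ζ * E') := by
    calc E' * (T * Ra * Ti) * E' = (E' * T) * Ra * (Ti * E') := by simp only [mul_assoc]
      _ = E' * E * (Ti' * (Ra * T')) * E * E' := by rw [hmulT, hTimul]; simp only [mul_assoc]
      _ = E' * (E * Ra * E) * E' := by
        rw [cRaT'.eq, ← mul_assoc Ti', hTT', one_mul]; simp only [mul_assoc]
      _ = v • (ζ * (E' * E * E')) := by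
        rw [hζ]
        simp only [mul_smul_comm, smul_mul_assoc]
        rw [← mul_assoc E' ζ, ← cζE'.eq]
        simp only [mul_assoc]
      _ = _ := by rw [hsandE]
  have sb : E' * (b * Rb) * E' = w - x • E' := by
    rw [bRb, mul_sub, sub_mul, mul_smul_comm, smul_mul_assoc, hw, smul_smul, huv, one_smul,
      mul_one, hEsq]
  have sG : E' * (Rb * Ti) * E' = z • (Ra * E') + κ • (Ra * (w - x • E'))
      - κ • (ai * Ri * Ra * E') - (κ * v) • w + κ • (Ri * E') := by
    have e1 : Rb * Ti = T * Ra + κ • (b * Rb * Ra) - κ • (b * Ri * E * Ra)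
        - κ • Rb + κ • (Ri * E) := by
      rw [hTi, mul_sub, RbT, mul_smul_comm, mul_sub Rb, RbE, mul_one]
      simp only [mul_sub, sub_mul, mul_one, mul_assoc]
      rw [← mul_assoc Rb E, RbE, mul_assoc]
      module
    have e2 : E' * (Ri * E) * E' = Ri * E' := by
      rw [← mul_assoc, ← cRiE'.eq, mul_assoc, mul_assoc, ← mul_assoc E', hsandE]
    have e3 : E' * (T * Ra) * E' = z • (Ra * E') := by
      rw [← mul_assoc, mul_assoc, cRaE'.eq, ← mul_assoc, hsandT, smul_mul_assoc]
    have e4 : E' * (b * Rb * Ra) * E' = Ra * (w - x • E') := by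
      rw [← cRabRb.eq, ← mul_assoc, ← cRaE'.eq, mul_assoc, mul_assoc, ← mul_assoc E', sb]
    have e5 : E' * (b * Ri * E * Ra) * E' = ai * Ri * Ra * E' := by
      calc E' * (b * Ri * E * Ra) * E' = E' * (ai * Ri) * E * (Ra * E') := by
            rw [bRiE]; simp only [mul_assoc]
        _ = ai * Ri * (E' * E * E') * Ra := by
            rw [← caiRiE'.eq, cRaE'.eq]; simp only [mul_assoc]
        _ = _ := by rw [hsandE, mul_assoc, ← cRaE'.eq, mul_assoc, mul_assoc, mul_assoc]
    rw [e1]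
    simp only [mul_sub, sub_mul, mul_add, add_mul, mul_smul_comm, smul_mul_assoc, e2, e3, e5, hw,
      e4, smul_smul]
  have sH : E' * (E * Ra * Ti) * E' =
      zi • (Ri * E') - (κ * u) • (Ri * Ra * E') + κ • (ζ * Ri * E') := by
    have e1 : E * Ra * Ti = zi • (E * Ri) - (κ * u) • (E * Ri * Ra) + κ • (ζ * E * Ri) := by
      have h1 : Ra * Ti = T * Rb - (κ * u) • (Ra * Rb) + (κ * u) • (Ra * E * Rb) := by
        rw [hTi, mul_sub, RaT, bRb]
        simp only [mul_sub, sub_mul, mul_one, mul_smul_comm]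
        module
      rw [mul_assoc, h1, cRaRb.eq]
      simp only [mul_sub, mul_add, mul_smul_comm, ← mul_assoc]
      rw [hET, ERb, hζ]
      simp only [smul_mul_assoc]
      rw [mul_assoc ζ, ERb, smul_smul, mul_assoc κ, huv, mul_one, ← mul_assoc]
    have e2 : E' * (E * Ri) * E' = Ri * E' := by
      rw [mul_assoc, mul_assoc, cRiE'.eq, ← mul_assoc, ← mul_assoc, hsandE]
    have e3 : E' * (E * Ri * Ra) * E' = Ri * Ra * E' := by
      rw [mul_assoc E, mul_assoc, mul_assoc, (cRiE'.mul_left cRaE').eq, ← mul_assoc, ← mul_assoc,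
        hsandE]
    have e4 : E' * (ζ * E * Ri) * E' = ζ * Ri * E' := by
      rw [mul_assoc ζ, ← mul_assoc, ← cζE'.eq, mul_assoc, mul_assoc, ← mul_assoc E', e2, mul_assoc]
    rw [e1]
    simp only [mul_sub, sub_mul, mul_add, add_mul, mul_smul_comm, smul_mul_assoc, e2, e3, e4]
  have s2 : E' * (b * Rb * Ra * Ti) * E' = Ra * (u • (E' * (Rb * Ti) * E') - zi • E') := by
    rw [← cRabRb.eq, bRb, ← hsandTi]
    calc E' * (Ra * (u • Rb - 1) * Ti) * E' = (E' * Ra) * ((u • Rb - 1) * Ti) * E' := by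
          simp only [mul_assoc]
      _ = _ := by
          rw [← cRaE'.eq]
          simp only [mul_assoc, mul_sub, sub_mul, mul_smul_comm, smul_mul_assoc, one_mul]
  have s3 : E' * (b * Rb * E * Ra * Ti) * E' = ai * Ri * (E' * (E * Ra * Ti) * E') := by
    rw [mul_assoc b, RbE, ← mul_assoc b, bRiE]
    calc E' * (ai * Ri * E * Ra * Ti) * E' = E' * (ai * Ri) * (E * Ra * Ti * E') := by
          simp only [mul_assoc]
      _ = _ := by rw [← caiRiE'.eq]; simp only [mul_assoc]
  have key : v • w = v • (ζ * E') + κ • (Ra * (u • (E' * (Rb * Ti) * E') - zi • E'))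
      - κ • (ai * Ri * (E' * (E * Ra * Ti) * E')) := by
    rw [← hw, ← s1, ← s2, ← s3]
    conv_lhs => rw [RbExp]
    simp only [mul_sub, sub_mul, mul_add, add_mul, mul_smul_comm, smul_mul_assoc, mul_one]
    module
  rw [sG, sH] at key
  have key2 := congrArg (u • ·) key
  simp only [smul_add, smul_sub, smul_smul, huv, one_smul] at key2 ⊢
  refine key2.trans ?_
  simp only [mul_comm u, mul_add, mul_sub, mul_smul_comm, smul_sub, smul_add, smul_smul]

theorem bb_resolution {S M : Type*} [CommRing S] [AddCommGroup M] [Module S M]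
    {u v κ κi q qi z zi x s a ai Ra Ri Rp Rm ζ : S} {e w : M}
    (huv : u * v = 1) (hκ : κ = q - qi) (hκi : κ * κi = 1) (hq : q * qi = 1)
    (hx : x = 1 + (z - zi) * κi) (hs : s * (u ^ 2 - 1) = u ^ 2)
    (ha : a * ai = 1) (hRa : (u - a) * Ra = 1) (hRi : (u - ai) * Ri = 1)
    (hRp : (u - q ^ 2 * a) * Rp = 1) (hRm : (u - qi ^ 2 * a) * Rm = 1)
    (h : w = ζ • e + (κ * u) • (Ra • (u • (z • (Ra • e) + κ • (Ra • (w - x • e))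
          - κ • ((ai * Ri * Ra) • e) - (κ * v) • w + κ • (Ri • e)) - zi • e))
        - (κ * u) • ((ai * Ri) • (zi • (Ri • e) - (κ * u) • ((Ri * Ra) • e)
          + κ • ((ζ * Ri) • e)))) :
    w + (zi * κi) • e - s • e = ((ζ + zi * κi - s) * ((u - a) ^ 2 * (u - qi ^ 2 * ai)
      * (u - q ^ 2 * ai) * (Ri * Ri) * (Rp * Rm))) • e := by
  have hα : 1 - κ ^ 2 * u ^ 2 * Ra ^ 2 + κ ^ 2 * u * Ra =
      Ra ^ 2 * ((u - q ^ 2 * a) * (u - qi ^ 2 * a)) := by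
    subst hκ
    linear_combination (-((u - a) * Ra + 1) - (q - qi) ^ 2 * u * Ra) * hRa
      + Ra ^ 2 * (2 * u * a - a ^ 2 * (q * qi + 1)) * hq
  have hγ : 1 - κ ^ 2 * u * ai * Ri ^ 2 =
      Ri ^ 2 * ((u - q ^ 2 * ai) * (u - qi ^ 2 * ai)) := by
    subst hκ
    linear_combination -((u - ai) * Ri + 1) * hRi
      + Ri ^ 2 * (2 * u * ai - ai ^ 2 * (q * qi + 1)) * hq
  have hdiff : u ^ 2 * Ra ^ 2 - u * Ra - u * ai * Ri ^ 2 =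
      u * (Ra ^ 2 * Ri ^ 2 * (a - ai) * (u ^ 2 - 1)) := by
    linear_combination (u * Ra + u * ai * Ri ^ 2 * ((u - a) * Ra + 1)) * hRa
      - u * a * Ra ^ 2 * ((u - ai) * Ri + 1) * hRi
      + u * Ra ^ 2 * Ri ^ 2 * (ai - a) * ha
  have hcub : -(u ^ 2 * Ra ^ 2) - u ^ 2 * ai * Ri * Ra ^ 2 + u ^ 2 * Ri * Ra
      + u ^ 2 * ai * Ri ^ 2 * Ra = u ^ 3 * (Ra ^ 2 * Ri ^ 2 * (ai - a)) := by
    linear_combination (u ^ 2 * Ra ^ 2 - u ^ 2 * Ri * Ra + u ^ 3 * Ra ^ 2 * Ri) * hRi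
      - u ^ 3 * Ra * Ri ^ 2 * hRa
  have key : (z * κ * u ^ 2 * Ra ^ 2 - κ ^ 2 * u ^ 2 * Ra ^ 2 * x
      - κ ^ 2 * u ^ 2 * ai * Ri * Ra ^ 2 + κ ^ 2 * u ^ 2 * Ri * Ra - κ * u * zi * Ra
      - κ * u * zi * ai * Ri ^ 2 + κ ^ 2 * u ^ 2 * ai * Ri ^ 2 * Ra) =
      (zi * κi - s) * ((1 - κ ^ 2 * u * ai * Ri ^ 2)
        - (1 - κ ^ 2 * u ^ 2 * Ra ^ 2 + κ ^ 2 * u * Ra)) := by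
    subst hx
    linear_combination κ ^ 2 * hcub + s * κ ^ 2 * hdiff
      + κ ^ 2 * u * Ra ^ 2 * Ri ^ 2 * (a - ai) * hs
      + (κ * u * zi * (Ra + ai * Ri ^ 2) - z * κ * u ^ 2 * Ra ^ 2) * hκi
  have hw : (1 - κ ^ 2 * u ^ 2 * Ra ^ 2 + κ ^ 2 * u * Ra) • (w + (zi * κi) • e - s • e) =
      ((ζ + zi * κi - s) * (1 - κ ^ 2 * u * ai * Ri ^ 2)) • e := by
    linear_combination (norm := module) h + key • e - (κ ^ 2 * u * Ra) • huv • w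
  rw [hα, hγ] at hw
  have hunit : (u - a) ^ 2 * (Rp * Rm) * (Ra ^ 2 * ((u - q ^ 2 * a) * (u - qi ^ 2 * a))) = 1 := by
    calc _ = ((u - a) * Ra) ^ 2 * ((u - q ^ 2 * a) * Rp) * ((u - qi ^ 2 * a) * Rm) := by ring
      _ = 1 := by rw [hRa, hRp, hRm]; ring
  have h1 := congrArg (((u - a) ^ 2 * (Rp * Rm)) • ·) hw
  simp only [smul_smul, hunit, one_smul] at h1
  rw [h1]
  congr 1
  ring

namespace AffBMW

variable {C : Type*} [CommRing C] {k : ℕ} {q z : Cˣ} {Z₀ : ℤ → C} {A : Type*} [Ring A]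
  [Algebra C A] (B : AffBMW C k q z Z₀ A)

/-- The subalgebra `W_m` generated by the `T_j, E_j` and `Y_j^{±1}` supported on the first `m`
strands. -/
abbrev lower (m : ℕ) : Subalgebra C A :=
  Algebra.adjoin C
    ({x : A | ∃ j, ∃ hj : j + 1 < k, j + 2 ≤ m ∧ (x = B.T j hj ∨ x = B.E j hj)} ∪
      {x : A | ∃ j, j < m ∧ (x = B.Y j ∨ x = B.Yinv j)})

theorem commute_Tinv {i : ℕ} (h : i + 1 < k) {x : A} (hx : Commute x (B.T i h)) :
    Commute x (B.Tinv i h) :=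
  hx.units_inv_right (u := ⟨B.T i h, B.Tinv i h, B.T_Tinv i h, B.Tinv_T i h⟩)

theorem commute_Yinv {i : ℕ} (h : i < k) {x : A} (hx : Commute x (B.Y i)) :
    Commute x (B.Yinv i) :=
  hx.units_inv_right (u := ⟨B.Y i, B.Yinv i, B.Y_Yinv i h, B.Yinv_Y i h⟩)

theorem T_mul_Y (i : ℕ) (h : i + 1 < k) : B.T i h * B.Y i = B.Y (i + 1) * B.Tinv i h := by
  rw [B.Y_succ i h, mul_assoc (B.T i h * B.Y i), B.T_Tinv, mul_one]

theorem Tinv_mul_Y (i : ℕ) (h : i + 1 < k) :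
    B.Tinv i h * B.Y (i + 1) = B.Y i * B.T i h := by
  rw [B.Y_succ i h, mul_assoc (B.T i h), ← mul_assoc, B.Tinv_T, one_mul]

theorem Tinv_eq (i : ℕ) (h : i + 1 < k) :
    B.Tinv i h = B.T i h - ((q : C) - ((q⁻¹ : Cˣ) : C)) • (1 - B.E i h) := by
  have h1 := B.E_def i h
  rw [B.T_mul_Y, ← mul_smul_comm, ← mul_sub] at h1
  have h2 := congrArg (B.Yinv (i + 1) * ·) h1
  simpa only [← mul_assoc, B.Yinv_Y (i + 1) h, one_mul] using h2

theorem Y_mul_E (i : ℕ) (h : i + 1 < k) :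
    B.Y (i + 1) * B.E i h = B.Yinv i * B.E i h := by
  calc B.Y (i + 1) * B.E i h = B.Yinv i * B.Y i * B.Y (i + 1) * B.E i h := by
        rw [B.Yinv_Y i (by omega), one_mul]
    _ = _ := by rw [mul_assoc (B.Yinv i), mul_assoc (B.Yinv i), B.YY_E]

theorem commute_T_T {i j : ℕ} (hi : i + 1 < k) (hj : j + 1 < k) (hij : i + 2 ≤ j) :
    Commute (B.T i hi) (B.T j hj) :=
  B.braid_far i j hi hj hij

theorem commute_Y_T_of_lt (j : ℕ) : ∀ {i : ℕ} (hi : i + 1 < k), j < i →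
    Commute (B.Y j) (B.T i hi) := by
  induction j with
  | zero =>
    intro i hi hji
    rw [B.Y_zero]
    exact Commute.smul_left (B.X_T i hi hji) _
  | succ j ih =>
    intro i hi hji
    have hT := B.commute_T_T (i := j) (by omega) hi (by omega)
    rw [B.Y_succ j (by omega)]
    exact (hT.mul_left (ih hi (by omega))).mul_left hT

theorem commute_T_Y_of_add_two_le {i : ℕ} (hi : i + 1 < k) {j : ℕ} (hij : i + 2 ≤ j) :
    j < k → Commute (B.T i hi) (B.Y j) := by
  induction j, hij using Nat.le_induction with
  | base =>
    intro hk
    have hY : B.Y i * B.T (i + 1) hk = B.T (i + 1) hk * B.Y i :=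
      (B.commute_Y_T_of_lt i hk (by omega)).eq
    have hb := B.braid i hk
    rw [B.Y_succ (i + 1) hk, B.Y_succ i hi]
    generalize B.T (i + 1) hk = t at *
    generalize B.T i hi = s at *
    calc s * (t * (s * B.Y i * s) * t) = (s * t * s) * B.Y i * s * t := by simp only [mul_assoc]
      _ = t * s * (B.Y i * t) * s * t := by
        rw [hb, hY]; simp only [mul_assoc]
      _ = t * s * B.Y i * (t * s * t) := by simp only [mul_assoc]
      _ = t * (s * B.Y i * s) * t * s := by rw [← hb]; simp only [mul_assoc]
  | succ j hij ih =>
    intro hk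
    have hT := B.commute_T_T hi (j := j) hk hij
    rw [B.Y_succ j hk]
    exact (hT.mul_right (ih (by omega))).mul_right hT

theorem commute_Y_Y_succ (i : ℕ) (h : i + 1 < k) : Commute (B.Y i) (B.Y (i + 1)) := by
  induction i with
  | zero =>
    have hX : Commute B.X (B.T 0 h * B.X * B.T 0 h) := by
      have := B.XTXT h
      simpa only [Commute, SemiconjBy, mul_assoc] using this
    rw [B.Y_succ 0 h, B.Y_zero, mul_smul_comm, smul_mul_assoc]
    exact (hX.smul_left _).smul_right _
  | succ i ih =>
    have h1 := B.commute_T_Y_of_add_two_le (i := i) (by omega) (j := i + 2) le_rfl h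
    have h2 : Commute (B.Y i) (B.Y (i + 2)) := by
      have h3 := B.commute_Y_T_of_lt i h (by omega)
      rw [B.Y_succ (i + 1) h]
      exact (h3.mul_right (ih (by omega))).mul_right h3
    rw [B.Y_succ i (by omega)]
    exact (h1.mul_left h2).mul_left h1

theorem commute_Y_Y {i j : ℕ} (hij : i < j) : j < k → Commute (B.Y i) (B.Y j) := by
  induction j, hij using Nat.le_induction with
  | base => exact B.commute_Y_Y_succ i
  | succ j hij ih =>
    intro hk
    have hT := B.commute_Y_T_of_lt i (i := j) hk hij
    rw [B.Y_succ j hk]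
    exact (hT.mul_right (ih (by omega))).mul_right hT

/-- `T_i T_{i+1}` intertwines `T_i` and `T_{i+1}`. -/
theorem semiconjBy_T (i : ℕ) (h : i + 2 < k) :
    SemiconjBy (B.T i (by omega) * B.T (i + 1) h) (B.T i (by omega)) (B.T (i + 1) h) := by
  rw [SemiconjBy, B.braid, mul_assoc]

theorem E_mul_Y (i : ℕ) (h : i + 1 < k) : B.E i h * B.Y (i + 1) = B.E i h * B.Yinv i := by
  calc B.E i h * B.Y (i + 1) = B.E i h * (B.Y (i + 1) * (B.Y i * B.Yinv i)) := by
        rw [B.Y_Yinv i (by omega), mul_one]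
    _ = _ := by
      rw [← mul_assoc (B.Y (i + 1)), ← (B.commute_Y_Y_succ i h).eq, ← mul_assoc, B.E_YY]

variable [Invertible ((q : C) - ((q⁻¹ : Cˣ) : C))]

theorem E_eq (i : ℕ) (h : i + 1 < k) :
    B.E i h = 1 - ⅟((q : C) - ((q⁻¹ : Cˣ) : C)) • (B.T i h - B.Tinv i h) := by
  rw [B.Tinv_eq, sub_sub_cancel, smul_smul, invOf_mul_self, one_smul, sub_sub_cancel]

theorem commute_E {i : ℕ} (h : i + 1 < k) {x : A} (hx : Commute x (B.T i h)) :
    Commute x (B.E i h) := by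
  rw [B.E_eq]
  exact (Commute.one_right x).sub_right ((hx.sub_right (B.commute_Tinv h hx)).smul_right _)

theorem E_mul_E (i : ℕ) (h : i + 1 < k) : B.E i h * B.E i h =
    (1 + ((z : C) - ((z⁻¹ : Cˣ) : C)) * ⅟((q : C) - ((q⁻¹ : Cˣ) : C))) • B.E i h := by
  conv_lhs => rw [B.E_eq i h, sub_mul, smul_mul_assoc, sub_mul, one_mul, ← B.E_eq i h, B.T_E,
    B.Tinv_E]
  module

theorem E_succ_mul_E_mul_E_succ (i : ℕ) (h : i + 2 < k) :
    B.E (i + 1) h * B.E i (by omega) * B.E (i + 1) h = B.E (i + 1) h := by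
  rw [B.E_eq i (by omega), mul_sub, sub_mul, mul_smul_comm, smul_mul_assoc, mul_sub, sub_mul,
    mul_one, B.E_mul_E]
  have h1 := B.ETE_down (i + 1) h (by omega) (by omega)
  have h2 := B.ETinvE_down (i + 1) h (by omega) (by omega)
  simp only [Nat.add_sub_cancel] at h1 h2
  rw [h1, h2]
  module

/-- `T_i T_{i+1}` intertwines `E_i` and `E_{i+1}`. -/
theorem semiconjBy_E (i : ℕ) (h : i + 2 < k) :
    SemiconjBy (B.T i (by omega) * B.T (i + 1) h) (B.E i (by omega)) (B.E (i + 1) h) := by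
  have h1 := B.semiconjBy_T i h
  have h2 : SemiconjBy (B.T i (by omega) * B.T (i + 1) h) (B.Tinv i (by omega))
      (B.Tinv (i + 1) h) :=
    SemiconjBy.units_inv_right
      (x := ⟨B.T i (by omega), B.Tinv i (by omega), B.T_Tinv i _, B.Tinv_T i _⟩)
      (y := ⟨B.T (i + 1) h, B.Tinv (i + 1) h, B.T_Tinv _ _, B.Tinv_T _ _⟩) h1
  rw [B.E_eq, B.E_eq]
  have h3 := h1.sub_right h2
  unfold SemiconjBy at h3 ⊢
  rw [mul_sub, sub_mul, mul_one, one_mul, mul_smul_comm, smul_mul_assoc, h3]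

theorem Tinv_mul_E_succ (i : ℕ) (h : i + 2 < k) : B.Tinv i (by omega) * B.E (i + 1) h =
    B.T (i + 1) h * B.E i (by omega) * B.E (i + 1) h := by
  have h1 : B.T i (by omega) * B.T (i + 1) h * B.E i (by omega) * B.E (i + 1) h =
      B.E (i + 1) h := by
    have h2 := B.ETE_down (i + 1) h (by omega) (by omega)
    simp only [Nat.add_sub_cancel] at h2
    rw [(B.semiconjBy_E i h).eq, mul_assoc, mul_assoc, B.T_E, mul_smul_comm, mul_smul_comm,
      ← mul_assoc, h2, smul_smul, Units.inv_mul, one_smul]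
  calc _ = B.Tinv i (by omega) *
        (B.T i (by omega) * B.T (i + 1) h * B.E i (by omega) * B.E (i + 1) h) := by rw [h1]
    _ = _ := by simp only [← mul_assoc, B.Tinv_T, one_mul]

theorem E_succ_mul_T (i : ℕ) (h : i + 2 < k) : B.E (i + 1) h * B.T i (by omega) =
    B.E (i + 1) h * B.E i (by omega) * B.Tinv (i + 1) h := by
  have h0 : B.E i (by omega) * (B.Tinv (i + 1) h * B.Tinv i (by omega)) =
      B.Tinv (i + 1) h * B.Tinv i (by omega) * B.E (i + 1) h :=
    (SemiconjBy.units_inv_symm_left (a := ⟨B.T i (by omega) * B.T (i + 1) h,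
      B.Tinv (i + 1) h * B.Tinv i (by omega),
      by rw [mul_assoc, ← mul_assoc _ (B.Tinv (i + 1) h), B.T_Tinv, one_mul, B.T_Tinv],
      by rw [mul_assoc, ← mul_assoc _ (B.T i _), B.Tinv_T, one_mul, B.Tinv_T]⟩)
      (B.semiconjBy_E i h)).eq.symm
  have h1 : B.E (i + 1) h * (B.E i (by omega) * (B.Tinv (i + 1) h * B.Tinv i (by omega))) =
      B.E (i + 1) h := by
    have h2 := B.ETinvE_down (i + 1) h (by omega) (by omega)
    simp only [Nat.add_sub_cancel] at h2
    rw [h0, ← mul_assoc, ← mul_assoc, B.E_Tinv, smul_mul_assoc, smul_mul_assoc, h2, smul_smul,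
      Units.mul_inv, one_smul]
  calc _ = B.E (i + 1) h * (B.E i (by omega) * (B.Tinv (i + 1) h * B.Tinv i (by omega))) *
        B.T i (by omega) := by rw [h1]
    _ = _ := by simp only [mul_assoc, B.Tinv_T, mul_one]

theorem commute_of_mem_adjoin {m : ℕ} {a x : A} (hm : m < k)
    (hx : x ∈ B.lower m)
    (hT : ∀ j (hj : j + 1 < k), j + 2 ≤ m → Commute a (B.T j hj))
    (hY : ∀ j, j < m → Commute a (B.Y j)) : Commute x a := by
  have hle := Algebra.adjoin_le (S := Subalgebra.centralizer C {a}) (s :=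
      ({x : A | ∃ j, ∃ hj : j + 1 < k, j + 2 ≤ m ∧ (x = B.T j hj ∨ x = B.E j hj)} ∪
        {x : A | ∃ j, j < m ∧ (x = B.Y j ∨ x = B.Yinv j)})) (by
    rintro y (⟨j, hj, hjm, rfl | rfl⟩ | ⟨j, hjm, rfl | rfl⟩) <;>
      rw [SetLike.mem_coe, Subalgebra.mem_centralizer_iff] <;> rintro _ rfl
    · exact hT j hj hjm
    · exact B.commute_E hj (hT j hj hjm)
    · exact hY j hjm
    · exact B.commute_Yinv (by omega) (hY j hjm)) hx
  rw [Subalgebra.mem_centralizer_iff] at hle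
  exact (hle a rfl).symm

theorem commute_mem_adjoin_Y {m : ℕ} {x : A} (hm : m < k)
    (hx : x ∈ B.lower m) {n : ℕ} (hmn : m ≤ n) (hn : n < k) :
    Commute x (B.Y n) :=
  B.commute_of_mem_adjoin hm hx
    (fun _ hj hjm => (B.commute_T_Y_of_add_two_le hj (by omega) hn).symm)
    fun _ hj => (B.commute_Y_Y (by omega) hn).symm

theorem commute_mem_adjoin_T {m : ℕ} {x : A} (hm : m < k)
    (hx : x ∈ B.lower m) {n : ℕ} (hmn : m ≤ n)
    (hn : n + 1 < k) : Commute x (B.T n hn) :=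
  B.commute_of_mem_adjoin hm hx
    (fun _ hj hjm => (B.commute_T_T hj hn (by omega)).symm)
    fun _ hj => (B.commute_Y_T_of_lt _ hn (by omega)).symm

end AffBMW

/-- The Beliakova–Blanchet recursion over a commutative ground ring containing `u`, obtained from
`bb_resolution` over the (commutative) bicommutant of `{a, ζ}`. -/
theorem bb_recursion_of_bmw {K L : Type*} [CommRing K] [Ring L] [Algebra K L]
    (u v κ κi q qi z zi s : K) (a ai b T Ti E T' Ti' E' Ra Rb Ri Rp Rm ζ w : L)
    (huv : u * v = 1) (hκ : κ = q - qi) (hκi : κ * κi = 1) (hq : q * qi = 1)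
    (hs : s * (u ^ 2 - 1) = u ^ 2)
    (haai : a * ai = 1) (haia : ai * a = 1)
    (hT : T * Ti = 1) (hTi : Ti = T - κ • (1 - E))
    (hbTi : b * Ti = T * a) (hTib : Ti * b = a * T)
    (hRa : (u • 1 - a) * Ra = 1) (hRa' : Ra * (u • 1 - a) = 1)
    (hRb : (u • 1 - b) * Rb = 1) (hRb' : Rb * (u • 1 - b) = 1)
    (hRi : (u • 1 - ai) * Ri = 1) (hRi' : Ri * (u • 1 - ai) = 1)
    (hRp : (u • 1 - q ^ 2 • a) * Rp = 1) (hRp' : Rp * (u • 1 - q ^ 2 • a) = 1)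
    (hRm : (u • 1 - qi ^ 2 • a) * Rm = 1) (hRm' : Rm * (u • 1 - qi ^ 2 • a) = 1)
    (hbE : b * E = ai * E) (hEb : E * b = E * ai)
    (hET : E * T = zi • E)
    (hmulT : E' * T = E' * E * Ti') (hTimul : Ti * E' = T' * E * E')
    (hsandT : E' * T * E' = z • E') (hsandTi : E' * Ti * E' = zi • E')
    (hsandE : E' * E * E' = E') (hEsq : E' * E' = (1 + (z - zi) * κi) • E')
    (hTT' : Ti' * T' = 1)
    (caT' : Commute a T') (caE' : Commute a E') (cab : Commute a b)
    (cζE' : Commute ζ E') (cζa : Commute ζ a)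
    (hζ : E * Ra * E = v • (ζ * E)) (hw : E' * Rb * E' = v • w) :
    w + (zi * κi) • E' - s • E' = (ζ + (zi * κi) • 1 - s • 1) * ((u • 1 - a) ^ 2 *
      (u • 1 - qi ^ 2 • ai) * (u • 1 - q ^ 2 • ai) * (Ri * Ri) * (Rp * Rm)) * E' := by
  have inv_comm : ∀ {x y y' : L}, y * y' = 1 → y' * y = 1 → Commute x y → Commute x y' :=
    fun {x y y'} h h' hxy => hxy.units_inv_right (u := ⟨y, y', h, h'⟩)
  have u_comm : ∀ {x y : L}, Commute x y → Commute x (u • 1 - y) :=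
    fun {x y} h => ((Commute.one_right x).smul_right u).sub_right h
  have cai : ∀ {x : L}, Commute x a → Commute x ai := fun h => inv_comm haai haia h
  have cRa : ∀ {x : L}, Commute x a → Commute x Ra := fun h => inv_comm hRa hRa' (u_comm h)
  have cRi : ∀ {x : L}, Commute x a → Commute x Ri := fun h => inv_comm hRi hRi' (u_comm (cai h))
  have cRp : ∀ {x : L}, Commute x a → Commute x Rp :=
    fun h => inv_comm hRp hRp' (u_comm (h.smul_right _))
  have cRm : ∀ {x : L}, Commute x a → Commute x Rm :=
    fun h => inv_comm hRm hRm' (u_comm (h.smul_right _))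
  have main := resolvent_bmw_relation u v κ z zi (1 + (z - zi) * κi) a ai b T Ti E T' Ti' E'
    Ra Rb Ri ζ w huv hT hTi hbTi hTib hRa hRa' hRb hRb' hRi hRi' hbE hEb hET hmulT hTimul
    hsandT hsandTi hsandE hEsq hTT' (cRa caT'.symm).symm (cRa caE'.symm).symm
    (cRa cab.symm).symm (cRi cab.symm).symm (cRi caE'.symm).symm (cai caE'.symm).symm
    cζE' hζ hw
  let S : Subalgebra K L := Subalgebra.centralizer K (Subalgebra.centralizer K {a, ζ})
  have mem_S : ∀ {x : L}, (∀ y, Commute y a → Commute y ζ → Commute y x) → x ∈ S := by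
    intro x hx
    rw [Subalgebra.mem_centralizer_iff]
    intro y hy
    rw [SetLike.mem_coe, Subalgebra.mem_centralizer_iff] at hy
    exact hx y (hy a (by simp)).symm (hy ζ (by simp)).symm
  let _ : CommRing S :=
    { (inferInstance : Ring S) with
      mul_comm := fun x y => Subtype.ext <| Set.centralizer_centralizer_comm_of_comm
        (S := {a, ζ}) (by
          rintro _ (rfl | rfl) _ (rfl | rfl)
          exacts [rfl, cζa.eq.symm, cζa.eq, rfl]) _ x.2 _ y.2 }
  let aS : S := ⟨a, mem_S fun _ h _ => h⟩
  let ζS : S := ⟨ζ, mem_S fun _ _ h => h⟩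
  let aiS : S := ⟨ai, mem_S fun _ h _ => cai h⟩
  let RaS : S := ⟨Ra, mem_S fun _ h _ => cRa h⟩
  let RiS : S := ⟨Ri, mem_S fun _ h _ => cRi h⟩
  let RpS : S := ⟨Rp, mem_S fun _ h _ => cRp h⟩
  let RmS : S := ⟨Rm, mem_S fun _ h _ => cRm h⟩
  let f : K →+* S := algebraMap K S
  have hf : ∀ (c : K) (x : L), f c • x = c • x := fun c x => algebraMap_smul S c x
  have hf1 : ∀ c : K, ((f c : S) : L) = c • 1 := fun c => Algebra.algebraMap_eq_smul_one c
  have res := bb_resolution (S := S) (M := L) (u := f u) (v := f v) (κ := f κ) (κi := f κi)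
    (q := f q) (qi := f qi) (z := f z) (zi := f zi) (x := f (1 + (z - zi) * κi)) (s := f s)
    (a := aS) (ai := aiS) (Ra := RaS) (Ri := RiS) (Rp := RpS) (Rm := RmS) (ζ := ζS)
    (e := E') (w := w)
    (by rw [← map_mul, huv, map_one]) (by rw [hκ, map_sub]) (by rw [← map_mul, hκi, map_one])
    (by rw [← map_mul, hq, map_one]) (by simp only [map_add, map_sub, map_mul, map_one])
    (by rw [← map_pow, ← map_one f, ← map_sub, ← map_mul, hs])
    (Subtype.ext haai) (Subtype.ext (by simpa [hf1] using hRa))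
    (Subtype.ext (by simpa [hf1] using hRi))
    (Subtype.ext (by simpa [hf1, smul_pow] using hRp))
    (Subtype.ext (by simpa [hf1, smul_pow] using hRm))
    (by simp only [← map_mul, hf]; exact main)
  simp only [← map_mul, ← map_pow, hf] at res
  rw [res, Subalgebra.smul_def]
  simp [hf1, smul_pow, smul_smul, mul_comm κi, aS, aiS, RiS, RpS, RmS, ζS]

section LaurentSeries

variable {A : Type*} [Ring A]

theorem cst_eq_ofPowerSeries (a : A) :
    cst a = HahnSeries.ofPowerSeries ℤ A (PowerSeries.C a) :=
  (HahnSeries.ofPowerSeries_C a).symm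

theorem commute_cst_ofPowerSeries {a : A} {f : PowerSeries A}
    (h : ∀ n, Commute a (PowerSeries.coeff n f)) :
    Commute (cst a) (HahnSeries.ofPowerSeries ℤ A f) := by
  have : Commute (PowerSeries.C a) f := PowerSeries.ext fun n => by
    rw [PowerSeries.coeff_C_mul, PowerSeries.coeff_mul_C, (h n).eq]
  rw [cst_eq_ofPowerSeries]
  exact this.map _

theorem commute_single (n : ℤ) {r : A} (hr : ∀ x, Commute r x) (f : LaurentSeries A) :
    Commute (HahnSeries.single n r : LaurentSeries A) f := by
  refine HahnSeries.ext (funext fun m => ?_)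
  rw [HahnSeries.coeff_single_mul, HahnSeries.coeff_mul_single, (hr _).eq]

theorem commute_Uvar (f : LaurentSeries A) : Commute (Uvar A) f :=
  commute_single _ Commute.one_left f

theorem Uvar_mul_single : Uvar A * HahnSeries.single 1 1 = 1 := by
  rw [Uvar, HahnSeries.single_mul_single, neg_add_cancel, mul_one]
  rfl

theorem Uvar_sub_cst (a : A) : Uvar A - cst a =
    Uvar A * HahnSeries.ofPowerSeries ℤ A (1 - PowerSeries.X * PowerSeries.C a) := by
  rw [map_sub, map_mul, map_one, HahnSeries.ofPowerSeries_X, ← cst_eq_ofPowerSeries, mul_sub,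
    mul_one, ← mul_assoc, Uvar_mul_single, one_mul]

theorem Uvar_sub_cst_mul_invU (a : A) : (Uvar A - cst a) * invU a = 1 := by
  have h : (1 - PowerSeries.X * PowerSeries.C a) *
      (PowerSeries.mk fun n => if n = 0 then 0 else a ^ (n - 1)) = PowerSeries.X := by
    ext (_ | _ | n) <;>
      simp [sub_mul, mul_assoc, PowerSeries.coeff_succ_X_mul, PowerSeries.coeff_X, pow_succ']
  rw [Uvar_sub_cst, invU, mul_assoc, ← map_mul, h, HahnSeries.ofPowerSeries_X, Uvar_mul_single]

theorem invU_mul_Uvar_sub_cst (a : A) : invU a * (Uvar A - cst a) = 1 := by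
  have h : (PowerSeries.mk fun n => if n = 0 then 0 else a ^ (n - 1)) *
      (1 - PowerSeries.X * PowerSeries.C a) = PowerSeries.X := by
    rw [PowerSeries.X_mul]
    ext (_ | _ | n) <;>
      simp [mul_sub, ← mul_assoc, PowerSeries.coeff_succ_mul_X, PowerSeries.coeff_X, pow_succ]
  rw [Uvar_sub_cst, (commute_Uvar _).eq, invU, ← mul_assoc, ← map_mul, h,
    HahnSeries.ofPowerSeries_X, ← (commute_Uvar _).eq, Uvar_mul_single]

theorem selfU2_mul_one_sub : selfU2 A * (1 - HahnSeries.single 1 1 ^ 2) = 1 := by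
  have h : (PowerSeries.mk fun n => if n % 2 = 0 then (1 : A) else 0) *
      (1 - PowerSeries.X ^ 2) = 1 := by
    rw [mul_sub, mul_one]
    ext (_ | _ | n)
    · simp
    · simp [PowerSeries.coeff_mul_X_pow', PowerSeries.coeff_one]
    · simp [PowerSeries.coeff_mul_X_pow', PowerSeries.coeff_one, Nat.add_mod_right n 2, add_assoc]
  rw [selfU2, ← HahnSeries.ofPowerSeries_X, ← map_pow, ← map_one (HahnSeries.ofPowerSeries ℤ A),
    ← map_sub, ← map_mul, h]

theorem commute_selfU2 (f : LaurentSeries A) : Commute (selfU2 A) f := by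
  have h1 : ∀ g : LaurentSeries A, Commute g (1 - HahnSeries.single 1 1 ^ 2) := fun g =>
    (Commute.one_right g).sub_right ((commute_single 1 Commute.one_left g).symm.pow_right 2)
  exact ((h1 f).units_inv_right (u := ⟨1 - HahnSeries.single 1 1 ^ 2, selfU2 A,
    by rw [← (h1 _).eq, selfU2_mul_one_sub], selfU2_mul_one_sub⟩)).symm

theorem selfU2_mul : selfU2 A * (Uvar A ^ 2 - 1) = Uvar A ^ 2 := by
  have h : Uvar A ^ 2 - 1 = (1 - HahnSeries.single 1 1 ^ 2) * Uvar A ^ 2 := by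
    rw [sub_mul, one_mul, ← (commute_single 1 Commute.one_left (Uvar A)).mul_pow,
      ← (commute_Uvar _).eq, Uvar_mul_single, one_pow]
  rw [h, ← mul_assoc, selfU2_mul_one_sub, one_mul]

theorem cst_mul_invU_mul_cst {e y : A} {x : ℕ → A} (h : ∀ n, e * y ^ n * e = x n * e) :
    cst e * invU y * cst e = HahnSeries.single 1 1 *
      (HahnSeries.ofPowerSeries ℤ A (PowerSeries.mk x) * cst e) := by
  have : PowerSeries.C e * (PowerSeries.mk fun n => if n = 0 then 0 else y ^ (n - 1)) *
      PowerSeries.C e = PowerSeries.X * (PowerSeries.mk x * PowerSeries.C e) := by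
    ext (_ | n)
    · simp
    · rw [PowerSeries.coeff_succ_X_mul, PowerSeries.coeff_mul_C, PowerSeries.coeff_mul_C,
        PowerSeries.coeff_C_mul]
      simpa using h n
  rw [cst_eq_ofPowerSeries, invU, ← HahnSeries.ofPowerSeries_X]
  simp only [← map_mul, this]

variable {C : Type*} [CommRing C] [Algebra C A]

/-- The scalars `C` inside the center of the Laurent series ring. -/
noncomputable def centralScalar (C A : Type*) [CommRing C] [Ring A] [Algebra C A] :
    C →+* Subring.center (LaurentSeries A) :=
  ((HahnSeries.C : A →+* LaurentSeries A).comp (algebraMap C A)).codRestrict _ fun c =>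
    Subring.mem_center_iff.mpr fun f =>
      (commute_single 0 (Algebra.commutes c) f).symm

theorem cst_smul (c : C) (a : A) : cst (c • a) = centralScalar C A c • cst a := by
  rw [Algebra.smul_def]
  exact map_mul HahnSeries.C _ _

theorem smul_one_eq_centralScalar (c : C) :
    c • (1 : LaurentSeries A) = centralScalar C A c • 1 := by
  have : (1 : LaurentSeries A) = cst 1 := rfl
  rw [this, ← cst_smul]
  refine HahnSeries.ext (funext fun n => ?_)
  rw [HahnSeries.coeff_smul, cst, cst, HahnSeries.C_apply, HahnSeries.C_apply,
    HahnSeries.coeff_single, HahnSeries.coeff_single]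
  split_ifs <;> simp

end LaurentSeries

section Recursion

variable {C : Type*} [CommRing C] {k : ℕ} {q z : Cˣ} {Z₀ : ℤ → C} {A : Type*} [Ring A]
  [Algebra C A]

theorem commute_invU {x : LaurentSeries A} {a : A} (h : Commute x (cst a)) :
    Commute x (invU a) :=
  ((commute_Uvar x).symm.sub_right h).units_inv_right
    (u := ⟨Uvar A - cst a, invU a, Uvar_sub_cst_mul_invU a, invU_mul_Uvar_sub_cst a⟩)

theorem commute_bbFactor {x : LaurentSeries A} {a ai : A} (h : Commute x (cst a))
    (hi : Commute x (cst ai)) : Commute x (bbFactor q a ai) := by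
  have hU := (commute_Uvar x).symm
  have hs : ∀ (c : C) {y : A}, Commute x (cst y) → Commute x (cst (c • y)) := fun c y hy => by
    rw [cst_smul]
    exact hy.smul_right _
  exact (((((hU.sub_right h).pow_right 2).mul_right (hU.sub_right (hs _ hi))).mul_right
    (hU.sub_right (hs _ hi))).mul_right ((commute_invU hi).mul_right (commute_invU hi))).mul_right
    ((commute_invU (hs _ h)).mul_right (commute_invU (hs _ h)))

theorem Commute.cst {a b : A} (h : Commute a b) : Commute (cst a) (cst b) :=
  h.map HahnSeries.C

variable [Invertible ((q : C) - ((q⁻¹ : Cˣ) : C))]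

/-- `Z⁺ + z⁻¹/(q - q⁻¹) - u²/(u² - 1)` where `Z⁺` has coefficients `x n`. -/
noncomputable def shiftedSeries (A : Type*) [Ring A] [Algebra C A] (q z : Cˣ)
    [Invertible ((q : C) - ((q⁻¹ : Cˣ) : C))] (x : ℕ → A) : LaurentSeries A :=
  HahnSeries.ofPowerSeries ℤ A (PowerSeries.mk x) +
    (((z⁻¹ : Cˣ) : C) * ⅟((q : C) - ((q⁻¹ : Cˣ) : C))) • (1 : LaurentSeries A) - selfU2 A

theorem commute_cst_shiftedSeries {a : A} {x : ℕ → A} (h : ∀ n, Commute a (x n)) :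
    Commute (cst a) (shiftedSeries A q z x) :=
  ((commute_cst_ofPowerSeries fun n => by rw [PowerSeries.coeff_mk]; exact h n).add_right
    (by rw [smul_one_eq_centralScalar]; exact (Commute.one_right _).smul_right _)).sub_right
    (commute_selfU2 _).symm

namespace AffBMW

variable (B : AffBMW C k q z Z₀ A)

set_option maxHeartbeats 2000000 in
theorem shiftedSeries_succ_mul_E {j : ℕ} (h : j + 2 < k) {x x' : ℕ → A}
    (hx : ∀ n, x n ∈ B.lower j)
    (hE : ∀ n, B.E j (by omega) * B.Y j ^ n * B.E j (by omega) = x n * B.E j (by omega))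
    (hE' : ∀ n, B.E (j + 1) h * B.Y (j + 1) ^ n * B.E (j + 1) h = x' n * B.E (j + 1) h) :
    shiftedSeries A q z x' * cst (B.E (j + 1) h) =
      shiftedSeries A q z x * bbFactor q (B.Y j) (B.Yinv j) * cst (B.E (j + 1) h) := by
  let φ := centralScalar C A
  let u : Subring.center (LaurentSeries A) :=
    ⟨Uvar A, Subring.mem_center_iff.mpr fun f => (commute_Uvar f).symm⟩
  let v : Subring.center (LaurentSeries A) :=
    ⟨HahnSeries.single 1 1, Subring.mem_center_iff.mpr fun f =>
      (commute_single 1 Commute.one_left f).symm⟩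
  let s : Subring.center (LaurentSeries A) :=
    ⟨selfU2 A, Subring.mem_center_iff.mpr fun f => (commute_selfU2 f).symm⟩
  have hu : u • (1 : LaurentSeries A) = Uvar A := mul_one _
  have hs : s • (1 : LaurentSeries A) = selfU2 A := mul_one _
  have hmul : ∀ {a b c : A}, a * b = c → cst a * cst b = cst c := fun {a b c} habc => by
    rw [← habc]
    exact (map_mul HahnSeries.C a b).symm
  have hsm : ∀ (c : C) (a : A), φ c • cst a = cst (c • a) := fun c a => (cst_smul c a).symm
  have hsm2 : ∀ (c : C) (a : A), φ c ^ 2 • cst a = cst (c ^ 2 • a) := fun c a => by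
    rw [← map_pow, hsm]
  have hone : (1 : LaurentSeries A) = cst 1 := rfl
  have hj : j + 1 < k := by omega
  have res := bb_recursion_of_bmw u v (φ ((q : C) - ((q⁻¹ : Cˣ) : C)))
    (φ (⅟((q : C) - ((q⁻¹ : Cˣ) : C)))) (φ q) (φ ((q⁻¹ : Cˣ) : C)) (φ z) (φ ((z⁻¹ : Cˣ) : C)) s
    (cst (B.Y j)) (cst (B.Yinv j)) (cst (B.Y (j + 1))) (cst (B.T j hj)) (cst (B.Tinv j hj))
    (cst (B.E j hj)) (cst (B.T (j + 1) h)) (cst (B.Tinv (j + 1) h)) (cst (B.E (j + 1) h))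
    (invU (B.Y j)) (invU (B.Y (j + 1))) (invU (B.Yinv j)) (invU ((q : C) ^ 2 • B.Y j))
    (invU (((q⁻¹ : Cˣ) : C) ^ 2 • B.Y j)) (HahnSeries.ofPowerSeries ℤ A (PowerSeries.mk x))
    (HahnSeries.ofPowerSeries ℤ A (PowerSeries.mk x') * cst (B.E (j + 1) h))
    (Subtype.ext Uvar_mul_single) (map_sub φ _ _) (by rw [← map_mul, mul_invOf_self, map_one])
    (by rw [← map_mul, Units.mul_inv, map_one]) (Subtype.ext selfU2_mul)
    (hmul (B.Y_Yinv j (by omega))) (hmul (B.Yinv_Y j (by omega)))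
    (hmul (B.T_Tinv j hj))
    (by
      rw [hone, B.Tinv_eq, cst, map_sub]
      exact congrArg _ ((cst_smul _ _).trans (congrArg _ (map_sub _ _ _))))
    (by rw [hmul rfl, hmul rfl, B.T_mul_Y])
    (by rw [hmul rfl, hmul rfl, B.Tinv_mul_Y])
    (by rw [hu, Uvar_sub_cst_mul_invU]) (by rw [hu, invU_mul_Uvar_sub_cst])
    (by rw [hu, Uvar_sub_cst_mul_invU]) (by rw [hu, invU_mul_Uvar_sub_cst])
    (by rw [hu, Uvar_sub_cst_mul_invU]) (by rw [hu, invU_mul_Uvar_sub_cst])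
    (by rw [hu, hsm2, Uvar_sub_cst_mul_invU]) (by rw [hu, hsm2, invU_mul_Uvar_sub_cst])
    (by rw [hu, hsm2, Uvar_sub_cst_mul_invU]) (by rw [hu, hsm2, invU_mul_Uvar_sub_cst])
    (by rw [hmul rfl, hmul rfl, B.Y_mul_E])
    (by rw [hmul rfl, hmul rfl, B.E_mul_Y])
    (by rw [hmul rfl, hsm, B.E_T])
    (by rw [hmul rfl, hmul rfl, hmul rfl, B.E_succ_mul_T])
    (by rw [hmul rfl, hmul rfl, hmul rfl, B.Tinv_mul_E_succ])
    (by
      rw [hmul rfl, hmul rfl, hsm]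
      exact congrArg _ (B.ETE_down (j + 1) h hj (by omega)))
    (by
      rw [hmul rfl, hmul rfl, hsm]
      exact congrArg _ (B.ETinvE_down (j + 1) h hj (by omega)))
    (by rw [hmul rfl, hmul rfl, B.E_succ_mul_E_mul_E_succ])
    (by rw [hmul rfl, B.E_mul_E, ← hsm, map_add, map_mul, map_sub, map_one])
    (hmul (B.Tinv_T (j + 1) h))
    (B.commute_Y_T_of_lt j h (by omega)).cst
    (B.commute_E h (B.commute_Y_T_of_lt j h (by omega))).cst
    (B.commute_Y_Y_succ j hj).cst
    (commute_cst_ofPowerSeries fun n => by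
      rw [PowerSeries.coeff_mk]
      exact (B.commute_E h (B.commute_mem_adjoin_T (by omega) (hx n) (by omega) h)).symm).symm
    (commute_cst_ofPowerSeries fun n => by
      rw [PowerSeries.coeff_mk]
      exact (B.commute_mem_adjoin_Y (by omega) (hx n) le_rfl (by omega)).symm).symm
    (cst_mul_invU_mul_cst hE) (cst_mul_invU_mul_cst hE')
  have h1 : ∀ y : LaurentSeries A, shiftedSeries A q z x' * y =
      HahnSeries.ofPowerSeries ℤ A (PowerSeries.mk x') * y +
        (φ ((z⁻¹ : Cˣ) : C) * φ (⅟((q : C) - ((q⁻¹ : Cˣ) : C)))) • y - s • y := fun y => by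
    rw [shiftedSeries, smul_one_eq_centralScalar, sub_mul, add_mul, smul_mul_assoc, one_mul,
      map_mul]
    rfl
  rw [h1, res, shiftedSeries, bbFactor, smul_one_eq_centralScalar, ← map_mul, hs, hu, hsm2, hsm2]

theorem shiftedSeries_mul_E (Zc : ℕ → ℕ → A) (hmem : ∀ m n, m + 1 < k → Zc m n ∈ B.lower m)
    (hE : ∀ m (hm : m + 1 < k) n, B.E m hm * B.Y m ^ n * B.E m hm = Zc m n * B.E m hm) (m : ℕ)
    (hm : m + 1 < k) :
    shiftedSeries A q z (Zc m) * cst (B.E m hm) =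
      shiftedSeries A q z (Zc 0) *
        ((List.range m).map fun j => bbFactor q (B.Y j) (B.Yinv j)).prod * cst (B.E m hm) := by
  induction m with
  | zero => simp
  | succ m ih =>
    have hm' : m + 1 < k := by omega
    have comm_bb : ∀ {x : LaurentSeries A} {j : ℕ}, j < k → Commute x (cst (B.Y j)) →
        Commute x (bbFactor q (B.Y j) (B.Yinv j)) := fun {x j} hj hx =>
      commute_bbFactor hx (hx.units_inv_right (u := ⟨cst (B.Y j), cst (B.Yinv j),
        by rw [cst, cst, ← map_mul, B.Y_Yinv j hj, map_one],
        by rw [cst, cst, ← map_mul, B.Yinv_Y j hj, map_one]⟩))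
    have comm_prod : ∀ {x : LaurentSeries A}, (∀ j < m, Commute x (cst (B.Y j))) →
        Commute x ((List.range m).map fun j => bbFactor q (B.Y j) (B.Yinv j)).prod :=
      fun {x} hx => Commute.list_prod_right _ _ fun y hy => by
        obtain ⟨j, hj, rfl⟩ := List.mem_map.mp hy
        exact comm_bb (by have := List.mem_range.mp hj; omega) (hx j (List.mem_range.mp hj))
    have hcs : ∀ {i : ℕ}, i ≤ m → Commute (shiftedSeries A q z (Zc i)) (cst (B.Y m)) :=
      fun {i} hi => (commute_cst_shiftedSeries fun n =>
        (B.commute_mem_adjoin_Y (by omega) (hmem i n (by omega)) hi (by omega)).symm).symm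
    have hYE : ∀ {j : ℕ}, j < m + 1 → Commute (cst (B.E (m + 1) hm)) (cst (B.Y j)) := fun {j} hj =>
      (B.commute_E hm (B.commute_Y_T_of_lt j hm hj)).symm.cst
    have hcE : ∀ {i : ℕ}, i ≤ m → Commute (shiftedSeries A q z (Zc i)) (cst (B.E (m + 1) hm)) :=
      fun {i} hi => (commute_cst_shiftedSeries fun n =>
        (B.commute_E hm (B.commute_mem_adjoin_T (by omega) (hmem i n (by omega)) (by omega)
          hm)).symm).symm
    have hb := comm_bb (by omega) (hcs le_rfl)
    have hb0 := comm_bb (by omega) (hcs (Nat.zero_le m))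
    have hPb := (comm_prod (x := bbFactor q (B.Y m) (B.Yinv m)) fun j hj =>
      (comm_bb (by omega) (B.commute_Y_Y hj (by omega)).cst).symm).eq
    have hPE := (comm_prod fun j hj => hYE (by omega)).eq
    have hEE : cst (B.E (m + 1) hm) =
        cst (B.E (m + 1) hm) * cst (B.E m hm') * cst (B.E (m + 1) hm) := by
      conv_lhs => rw [← B.E_succ_mul_E_mul_E_succ m hm]
      simp only [cst, map_mul]
    have ih' := ih hm'
    rw [B.shiftedSeries_succ_mul_E hm (fun n => hmem m n hm') (hE m hm') (hE (m + 1) hm),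
      List.range_succ, List.map_append, List.prod_append, List.map_singleton, List.prod_singleton]
    have hcE0 := hcE (Nat.zero_le m)
    replace hcE := hcE le_rfl
    generalize ((List.range m).map fun j => bbFactor q (B.Y j) (B.Yinv j)).prod = P at *
    generalize bbFactor q (B.Y m) (B.Yinv m) = b at *
    generalize shiftedSeries A q z (Zc m) = S at *
    generalize shiftedSeries A q z (Zc 0) = S₀ at *
    generalize cst (B.E (m + 1) hm) = e' at *
    generalize cst (B.E m hm') = e at *
    have key : S * e' = S₀ * P * e' := by
      calc S * e' = e' * (S * e) * e' := by
            conv_lhs => rw [hEE, ← mul_assoc, ← mul_assoc, hcE.eq]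
            simp only [mul_assoc]
        _ = S₀ * P * (e' * e * e') := by
            have : Commute e' (S₀ * P) := hcE0.symm.mul_right hPE
            rw [ih', ← mul_assoc, this.eq]
            simp only [mul_assoc]
        _ = _ := by rw [← hEE]
    rw [hb.eq, mul_assoc, key, ← mul_assoc, ← mul_assoc, ← mul_assoc, ← hb0.eq, mul_assoc S₀, hPb,
      ← mul_assoc]

end AffBMW

end Recursion

/-- Beliakova–Blanchet recursion (3.34) and product formula (3.35), affine
case.  All indices are 0-indexed: the paper's `E_{m+1}`, `Y_{m+1}`, `Z_m` correspond to
`E m _`, `Y m`, `Zc m` here; the subalgebra `W_m` is generated by the `T j _, E j _` with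
`j + 2 ≤ m` and the `Y j, Yinv j` with `j < m`. -/
theorem affine_BMW_BB_recursion
    (C : Type*) [CommRing C] (k : ℕ) (q z : Cˣ) (Z₀ : ℤ → C)
    (A : Type*) [Ring A] [Algebra C A]
    [Invertible ((q : C) - ((q⁻¹ : Cˣ) : C))]
    (hk : 3 ≤ k)
    (B : AffBMW C k q z Z₀ A)
    (Zc : ℕ → ℤ → A)
    (hmem : ∀ m (ℓ : ℤ), m + 1 < k → Zc m ℓ ∈ Algebra.adjoin C
      ({x : A | ∃ j, ∃ hj : j + 1 < k, j + 2 ≤ m ∧ (x = B.T j hj ∨ x = B.E j hj)} ∪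
        {x : A | ∃ j, j < m ∧ (x = B.Y j ∨ x = B.Yinv j)}))
    (hz : ∀ m (hm : m + 1 < k) (ℓ : ℤ),
      B.E m hm * (if 0 ≤ ℓ then B.Y m ^ ℓ.toNat else B.Yinv m ^ (-ℓ).toNat) * B.E m hm =
        Zc m ℓ * B.E m hm) :
    -- (i) the recursion
    (∀ j (h : j + 2 < k),
      (HahnSeries.ofPowerSeries ℤ A (PowerSeries.mk fun n => Zc (j + 1) (n : ℤ)) +
            (((z⁻¹ : Cˣ) : C) * ⅟((q : C) - ((q⁻¹ : Cˣ) : C))) • (1 : LaurentSeries A) -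
            selfU2 A) * cst (B.E (j + 1) h) =
        (HahnSeries.ofPowerSeries ℤ A (PowerSeries.mk fun n => Zc j (n : ℤ)) +
            (((z⁻¹ : Cˣ) : C) * ⅟((q : C) - ((q⁻¹ : Cˣ) : C))) • (1 : LaurentSeries A) -
            selfU2 A) * bbFactor q (B.Y j) (B.Yinv j) * cst (B.E (j + 1) h)) ∧
    -- (ii) the product formula
    (∀ m (hm : m + 1 < k), 1 ≤ m →
      (HahnSeries.ofPowerSeries ℤ A (PowerSeries.mk fun n => Zc m (n : ℤ)) +
            (((z⁻¹ : Cˣ) : C) * ⅟((q : C) - ((q⁻¹ : Cˣ) : C))) • (1 : LaurentSeries A) -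
            selfU2 A) * cst (B.E m hm) =
        (HahnSeries.ofPowerSeries ℤ A (PowerSeries.mk fun n => Zc 0 (n : ℤ)) +
            (((z⁻¹ : Cˣ) : C) * ⅟((q : C) - ((q⁻¹ : Cˣ) : C))) • (1 : LaurentSeries A) -
            selfU2 A) *
          ((List.range m).map fun j => bbFactor q (B.Y j) (B.Yinv j)).prod *
          cst (B.E m hm)) := by
  have hE : ∀ m (hm : m + 1 < k) (n : ℕ),
      B.E m hm * B.Y m ^ n * B.E m hm = Zc m n * B.E m hm := fun m hm n => by
    simpa using hz m hm n
  exact ⟨fun j h => B.shiftedSeries_succ_mul_E h (fun n => hmem j n (by omega)) (hE j (by omega))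
      (hE (j + 1) h),
    fun m hm _ => B.shiftedSeries_mul_E (fun m n => Zc m n) (fun m n => hmem m n) hE m hm⟩
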